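/- arXiv:2401.13523 — 2 statements merged into one kernel-verified Lean document; each statement's English description precedes it below -/
import Mathlib

section
/- Let G be a finite group, T a G-transfer system, and T_h a saturated hull of T (i.e. T_h is a saturated G-transfer system containing T that is contained in every saturated G-transfer system containing T). If K ≤ H are subgroups of G that lie in the same connected component of T, then T_h contains the edge K → H. -/
/-- A `G`-transfer system: a relation on subgroups of `G` satisfying the subgroup,
reflexivity, transitivity, restriction, and conjugation conditions. -/
def IsTransferSystem {G : Type*} [Group G] (T : Subgroup G → Subgroup G → Prop) : Prop :=
  (∀ K H, T K H → K ≤ H) ∧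
  (∀ H, T H H) ∧
  (∀ L K H, T L K → T K H → T L H) ∧
  (∀ K H L, T K H → T (K ⊓ L) (H ⊓ L)) ∧
  (∀ K H (g : G), T K H →
    T (Subgroup.map (MulAut.conj g).toMonoidHom K) (Subgroup.map (MulAut.conj g).toMonoidHom H))

/-- Two subgroups are in the same connected component of `T` if they are related by
the reflexive-transitive closure of the symmetrization of `T`. -/
def SameComponent {G : Type*} [Group G] (T : Subgroup G → Subgroup G → Prop)
    (A B : Subgroup G) : Prop :=
  Relation.ReflTransGen (fun X Y => T X Y ∨ T Y X) A B

/-- A transfer system is saturated if `L ≤ K ≤ H` and `T L H` imply `T K H`. -/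
def IsSaturated {G : Type*} [Group G] (T : Subgroup G → Subgroup G → Prop) : Prop :=
  ∀ L K H : Subgroup G, L ≤ K → K ≤ H → T L H → T K H

/-- `Th` is a saturated hull of `T`: a saturated transfer system containing `T`
that is contained in every saturated transfer system containing `T`. -/
def IsSaturatedHull {G : Type*} [Group G] (T Th : Subgroup G → Subgroup G → Prop) : Prop :=
  IsTransferSystem Th ∧ IsSaturated Th ∧ (∀ K H, T K H → Th K H) ∧
  ∀ T'' : Subgroup G → Subgroup G → Prop, IsTransferSystem T'' → IsSaturated T'' →
    (∀ K H, T K H → T'' K H) → (∀ K H, Th K H → T'' K H)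

/-- Subgroups in the same component of `T` have a common source in any transfer system
containing `T`. -/
theorem SameComponent.exists_common_source {G : Type*} [Group G]
    {T S : Subgroup G → Subgroup G → Prop} (hS : IsTransferSystem S)
    (hTS : ∀ K H, T K H → S K H) {A B : Subgroup G} (h : SameComponent T A B) :
    ∃ M, S M A ∧ S M B := by
  obtain ⟨hle, hrefl, htrans, hres, -⟩ := hS
  induction h with
  | refl => exact ⟨A, hrefl A, hrefl A⟩
  | @tail X Y _ hXY ih =>
    obtain ⟨M, hMA, hMX⟩ := ih
    rcases hXY with hXY | hYX
    · exact ⟨M, hMA, htrans _ _ _ hMX (hTS _ _ hXY)⟩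
    · have hYX := hTS _ _ hYX
      have hM := hres _ _ M hYX
      have hY := hres _ _ Y hMX
      rw [inf_eq_right.mpr (hle _ _ hMX), inf_comm] at hM
      rw [inf_eq_right.mpr (hle _ _ hYX)] at hY
      exact ⟨M ⊓ Y, htrans _ _ _ hM hMA, hY⟩

/-- If `K ≤ H` lie in the same connected component of `T`, then any saturated hull
of `T` contains the edge `K → H`. -/
theorem hull_contains_edge_of_sameComponent {G : Type*} [Group G] [Finite G]
    (T Th : Subgroup G → Subgroup G → Prop) (hT : IsTransferSystem T)
    (hTh : IsSaturatedHull T Th) (K H : Subgroup G) (hKH : K ≤ H)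
    (hcomp : SameComponent T K H) :
    Th K H := by
  obtain ⟨hS, hsat, hTS, -⟩ := hTh
  obtain ⟨M, hMK, hMH⟩ := hcomp.exists_common_source hS hTS
  exact hsat M K H (hS.1 _ _ hMK) hKH hMH
end

section
/- Let T be a C_{p^r q^s}-transfer system, modeled on the grid Fin (r+1) × Fin (s+1), with exactly two connected components. Then the connected component of the vertex (0,0) is one of the following sets: V_ℓ = {(i,j) : i ≤ ℓ} for some ℓ < r; H_k = {(i,j) : j ≤ k} for some k < s; or L_{(ℓ,k)} = {(i,j) : i ≤ ℓ or j ≤ k} for some ℓ < r and k < s. -/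
/-- A `C_{p^r q^s}`-transfer system, modeled on the grid `Fin (r+1) × Fin (s+1)`
with the componentwise order and componentwise minimum `⊓`. -/
def IsGridTransferSystem {r s : ℕ}
    (T : Fin (r+1) × Fin (s+1) → Fin (r+1) × Fin (s+1) → Prop) : Prop :=
  (∀ v w, T v w → v ≤ w) ∧
  (∀ v, T v v) ∧
  (∀ u v w, T u v → T v w → T u w) ∧
  (∀ v w u, T v w → T (v ⊓ u) (w ⊓ u))

/-- Two vertices are in the same connected component of `T` if they are related by
the reflexive-transitive closure of the symmetrization of `T`. -/
def GridSameComponent {r s : ℕ}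
    (T : Fin (r+1) × Fin (s+1) → Fin (r+1) × Fin (s+1) → Prop)
    (v w : Fin (r+1) × Fin (s+1)) : Prop :=
  Relation.ReflTransGen (fun x y => T x y ∨ T y x) v w

/-- `(T, T')` is a compatible pair of grid transfer systems. -/
def GridCompatible {r s : ℕ}
    (T T' : Fin (r+1) × Fin (s+1) → Fin (r+1) × Fin (s+1) → Prop) : Prop :=
  (∀ v w, T v w → T' v w) ∧
  ∀ A B C : Fin (r+1) × Fin (s+1), B ≤ A → C ≤ A → T B A → T' (B ⊓ C) B → T' C A

/-- A grid transfer system is saturated if `u ≤ v ≤ w` and `T u w` imply `T v w`. -/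
def GridSaturated {r s : ℕ}
    (T : Fin (r+1) × Fin (s+1) → Fin (r+1) × Fin (s+1) → Prop) : Prop :=
  ∀ u v w : Fin (r+1) × Fin (s+1), u ≤ v → v ≤ w → T u w → T v w

/-- `Th` is a saturated hull of `T`. -/
def GridSaturatedHull {r s : ℕ}
    (T Th : Fin (r+1) × Fin (s+1) → Fin (r+1) × Fin (s+1) → Prop) : Prop :=
  IsGridTransferSystem Th ∧ GridSaturated Th ∧ (∀ v w, T v w → Th v w) ∧
  ∀ T'' : Fin (r+1) × Fin (s+1) → Fin (r+1) × Fin (s+1) → Prop,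
    IsGridTransferSystem T'' → GridSaturated T'' →
    (∀ v w, T v w → T'' v w) → (∀ v w, Th v w → T'' v w)

/-- `T` is lesser simply paired. -/
def GridLesserSimplyPaired {r s : ℕ}
    (T : Fin (r+1) × Fin (s+1) → Fin (r+1) × Fin (s+1) → Prop) : Prop :=
  ∀ T' : Fin (r+1) × Fin (s+1) → Fin (r+1) × Fin (s+1) → Prop,
    IsGridTransferSystem T' → (∀ v w, T v w → T' v w) →
    (GridCompatible T T' ↔ (GridSaturatedHull T T' ∨ T' = fun v w => v ≤ w))

/-- `T` has exactly two connected components: `(0,0)` and `(r,s)` are in different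
components and every vertex is in the component of one of them. -/
def GridTwoComponents {r s : ℕ}
    (T : Fin (r+1) × Fin (s+1) → Fin (r+1) × Fin (s+1) → Prop) : Prop :=
  ¬ GridSameComponent T (0, 0) (Fin.last r, Fin.last s) ∧
  ∀ v, GridSameComponent T (0, 0) v ∨ GridSameComponent T (Fin.last r, Fin.last s) v

namespace GridSameComponent

variable {r s : ℕ} {T : Fin (r+1) × Fin (s+1) → Fin (r+1) × Fin (s+1) → Prop}
  {v w x : Fin (r+1) × Fin (s+1)}

theorem symm (h : GridSameComponent T v w) : GridSameComponent T w v := by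
  have : Std.Symm (fun x y => T x y ∨ T y x) := ⟨fun _ _ => Or.symm⟩
  exact Relation.ReflTransGen.stdSymm.symm _ _ h

theorem trans (h : GridSameComponent T v w) (h' : GridSameComponent T w x) :
    GridSameComponent T v x :=
  Relation.ReflTransGen.trans h h'

/-- The connected components of a transfer system form a congruence for `⊓`. -/
theorem inf_right (hT : IsGridTransferSystem T) (h : GridSameComponent T v w)
    (u : Fin (r+1) × Fin (s+1)) : GridSameComponent T (v ⊓ u) (w ⊓ u) :=
  Relation.ReflTransGen.lift (· ⊓ u)
    (fun a b => Or.imp (hT.2.2.2 a b u) (hT.2.2.2 b a u)) _ _ h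

end GridSameComponent

/-- The component of the top vertex of a transfer system is a principal filter. -/
theorem exists_forall_gridSameComponent_last_iff_le {r s : ℕ}
    {T : Fin (r+1) × Fin (s+1) → Fin (r+1) × Fin (s+1) → Prop}
    (hT : IsGridTransferSystem T) :
    ∃ m, ∀ v, GridSameComponent T (Fin.last r, Fin.last s) v ↔ m ≤ v := by
  have inf_last (v : Fin (r+1) × Fin (s+1)) : (Fin.last r, Fin.last s) ⊓ v = v :=
    inf_eq_right.2 ⟨Fin.le_last _, Fin.le_last _⟩
  obtain ⟨m, hm⟩ := exists_minimal_of_wellFoundedLT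
    (GridSameComponent T (Fin.last r, Fin.last s)) ⟨_, Relation.ReflTransGen.refl⟩
  refine ⟨m, fun v => ⟨fun hv => ?_, fun hmv => ?_⟩⟩
  · have h := hv.inf_right hT m
    rw [inf_last] at h
    exact (hm.le_of_le (hm.prop.trans h) inf_le_right).trans inf_le_left
  · have h := hm.prop.inf_right hT v
    rw [inf_last, inf_eq_left.2 hmv] at h
    exact hm.prop.trans h.symm

/-- Below a nonzero `a : Fin (n+1)` lies a non-last `l` with `i ≤ l` if and only if `i < a`. -/
theorem Fin.exists_forall_le_iff_lt {n : ℕ} {a : Fin (n+1)} (ha : a ≠ 0) :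
    ∃ l : Fin (n+1), (l : ℕ) < n ∧ ∀ i, i ≤ l ↔ i < a := by
  obtain ⟨b, rfl⟩ := Fin.exists_succ_eq_of_ne_zero ha
  exact ⟨b.castSucc, b.isLt, fun i => Fin.le_castSucc_iff⟩

/-- If a grid transfer system has exactly two connected components, then the
component of `(0,0)` is a vertical rectangle `V_ℓ`, a horizontal rectangle `H_k`,
or an L-shape `L_{(ℓ,k)}`. -/
theorem two_components_shapes {r s : ℕ}
    (T : Fin (r+1) × Fin (s+1) → Fin (r+1) × Fin (s+1) → Prop)
    (hT : IsGridTransferSystem T) (h2 : GridTwoComponents T) :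
    (∃ l : Fin (r+1), (l : ℕ) < r ∧
      ∀ v, GridSameComponent T (0, 0) v ↔ v.1 ≤ l) ∨
    (∃ k : Fin (s+1), (k : ℕ) < s ∧
      ∀ v, GridSameComponent T (0, 0) v ↔ v.2 ≤ k) ∨
    (∃ l : Fin (r+1), ∃ k : Fin (s+1), (l : ℕ) < r ∧ (k : ℕ) < s ∧
      ∀ v, GridSameComponent T (0, 0) v ↔ (v.1 ≤ l ∨ v.2 ≤ k)) := by
  obtain ⟨hne, hcover⟩ := h2
  obtain ⟨⟨a, b⟩, hm⟩ := exists_forall_gridSameComponent_last_iff_le hT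
  have hzero (v) : GridSameComponent T (0, 0) v ↔ v.1 < a ∨ v.2 < b := by
    rw [← not_le, ← not_le, ← not_and_or, ← Prod.mk_le_mk, ← hm]
    exact ⟨fun h h' => hne (h.trans h'.symm), (hcover v).resolve_right⟩
  by_cases ha : a = 0
  · by_cases hb : b = 0
    · subst ha hb
      exact absurd ((hm (0, 0)).2 le_rfl).symm hne
    · obtain ⟨k, hk, hkb⟩ := Fin.exists_forall_le_iff_lt hb
      exact .inr (.inl ⟨k, hk, fun v => by simp [hzero, hkb, ha]⟩)
  · obtain ⟨l, hl, hla⟩ := Fin.exists_forall_le_iff_lt ha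
    by_cases hb : b = 0
    · exact .inl ⟨l, hl, fun v => by simp [hzero, hla, hb]⟩
    · obtain ⟨k, hk, hkb⟩ := Fin.exists_forall_le_iff_lt hb
      exact .inr (.inr ⟨l, k, hl, hk, fun v => by rw [hzero, hla, hkb]⟩)
end
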